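/- Let m ≥ 1. Then I_{c,F}^{(m)} = I_{c,F}^m + M, where M is the ideal of R generated by all products F_1^{a_1}F_2^{a_2}⋯F_s^{a_s} (with a_i ≥ 0) such that (1) |{i : a_i > 0}| ≥ s − c + 2, and (2) for every subset S ⊆ {1,…,s} with |S| = c one has Σ_{i∈S} a_i ≥ m. -/

import Mathlib

open MvPolynomial

/-- The star configuration ideal `I_{e,F} = ⋂_{|S| = e} ⟨F_i : i ∈ S⟩`. -/
noncomputable def starIdeal {k : Type*} [Field k] {n s : ℕ}
    (F : Fin s → MvPolynomial (Fin (n + 1)) k) (e : ℕ) :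
    Ideal (MvPolynomial (Fin (n + 1)) k) :=
  ⨅ (S : Finset (Fin s)) (_ : S.card = e), Ideal.span (F '' ↑S)

/-- The `m`-th symbolic power `I_{e,F}^{(m)} = ⋂_{|S| = e} ⟨F_i : i ∈ S⟩^m`. -/
noncomputable def starSymb {k : Type*} [Field k] {n s : ℕ}
    (F : Fin s → MvPolynomial (Fin (n + 1)) k) (e m : ℕ) :
    Ideal (MvPolynomial (Fin (n + 1)) k) :=
  ⨅ (S : Finset (Fin s)) (_ : S.card = e), (Ideal.span (F '' ↑S)) ^ m

namespace StarConfiguration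

variable {R ι : Type*} [CommRing R]

/-- The counting profile of an exponent vector: `profile a E t` is the number of `i ∈ E` with
`a i ≤ t`. -/
def profile (a : ι → ℕ) (E : Finset ι) (t : ℕ) : ℕ := (E.filter fun i => a i ≤ t).card

/-- The ideal generated by the monomials in the `F i`, `i ∈ E`, whose profile lies in `U`. -/
def profileIdeal (F : ι → R) (E : Finset ι) (U : Set (ℕ → ℕ)) : Ideal R :=
  Ideal.span {p | ∃ a : ι → ℕ, profile a E ∈ U ∧ p = ∏ i ∈ E, F i ^ a i}

/-- The profiles which land in `U` after adjoining one exponent equal to `j`. -/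
def slice (U : Set (ℕ → ℕ)) (j : ℕ) : Set (ℕ → ℕ) :=
  {N | (fun t => N t + if j ≤ t then 1 else 0) ∈ U}

/-- The ideal generated by the `F y ^ b` times a monomial in the `F i`, `i ∈ E`, with profile in
`slice U (b + j)`. When `F` is sufficiently regular this is the colon ideal of
`profileIdeal F (insert y E) U` by `F y ^ j`. -/
def shiftIdeal (F : ι → R) (E : Finset ι) (y : ι) (U : Set (ℕ → ℕ)) (j : ℕ) : Ideal R :=
  Ideal.span {p | ∃ (b : ℕ) (a : ι → ℕ), profile a E ∈ slice U (b + j) ∧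
    p = F y ^ b * ∏ i ∈ E, F i ^ a i}

/-- Membership in `U` only depends on the values at `t < m`, truncated at `c`, and is inherited by
smaller functions. -/
def Admissible (c m : ℕ) (U : Set (ℕ → ℕ)) : Prop :=
  ∀ N ∈ U, ∀ N' : ℕ → ℕ, (∀ t < m, min c (N' t) ≤ N t) → N' ∈ U

/-- Every `F x` is a nonzerodivisor modulo any `F i`, `i ∈ Z`, with `x ∉ Z` and `#Z ≤ C`. -/
def RegularUpTo (F : ι → R) (C : ℕ) : Prop :=
  ∀ (Z : Finset ι) (x : ι), x ∉ Z → Z.card ≤ C → ∀ f : R,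
    F x * f ∈ Ideal.span (F '' (Z : Set ι)) → f ∈ Ideal.span (F '' (Z : Set ι))

section Admissible

variable {c m j : ℕ} {U V : Set (ℕ → ℕ)}

lemma Admissible.of_le (hU : Admissible c m U) {N N' : ℕ → ℕ} (hN : N ∈ U) (h : N' ≤ N) :
    N' ∈ U :=
  hU N hN N' fun t _ => (min_le_right _ _).trans (h t)

lemma Admissible.slice (hU : Admissible c m U) (j : ℕ) : Admissible c m (slice U j) := by
  intro N hN N' h
  refine hU _ hN _ fun t ht => ?_
  have := h t ht
  split_ifs <;> omega

lemma Admissible.inter (hU : Admissible c m U) (hV : Admissible c m V) :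
    Admissible c m (U ∩ V) :=
  fun N hN N' h => ⟨hU N hN.1 N' h, hV N hN.2 N' h⟩

lemma Admissible.union (hU : Admissible c m U) (hV : Admissible c m V) :
    Admissible c m (U ∪ V) := by
  rintro N (hN | hN) N' h
  exacts [Or.inl (hU N hN N' h), Or.inr (hV N hN N' h)]

lemma Admissible.mono {c' : ℕ} (hU : Admissible c m U) (h : c ≤ c') : Admissible c' m U :=
  fun N hN N' h' => hU N hN N' fun t ht => (min_le_min_right _ h).trans (h' t ht)

lemma Admissible.truncate (hU : Admissible c m U) (c' : ℕ) :
    Admissible c' m {N | (fun t => min c' (N t)) ∈ U} := by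
  intro N hN N' h
  refine hU _ hN _ fun t ht => ?_
  have := h t ht
  omega

lemma Admissible.slice_subset (hU : Admissible c m U) (j : ℕ) :
    StarConfiguration.slice U j ⊆ U :=
  fun _ hN => hU.of_le hN fun _ => Nat.le_add_right _ _

lemma Admissible.slice_mono (hU : Admissible c m U) {i j : ℕ} (h : i ≤ j) :
    StarConfiguration.slice U i ⊆ StarConfiguration.slice U j := by
  intro N hN
  refine hU.of_le hN fun t => ?_
  dsimp only
  split_ifs <;> omega

lemma Admissible.subset_slice (hU : Admissible c m U) (h : m ≤ j) :
    U ⊆ StarConfiguration.slice U j := by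
  intro N hN
  refine hU N hN _ fun t ht => ?_
  rw [if_neg (by omega)]
  exact min_le_right _ _

lemma Admissible.mem_slice (hU : Admissible (c + 1) m U) {N : ℕ → ℕ} (hmono : Monotone N)
    (hN : N ∈ U) (h : (fun t => min c (N t)) ∈ StarConfiguration.slice U j) :
    N ∈ StarConfiguration.slice U j := by
  by_cases hj : c + 1 ≤ N j
  · refine hU N hN _ fun t _ => ?_
    split_ifs with ht
    · have := hmono ht
      omega
    · omega
  · refine hU _ h _ fun t _ => ?_
    dsimp only
    split_ifs with ht
    · omega
    · have := hmono (le_of_not_ge ht)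
      omega

end Admissible

section Ideals

variable {F : ι → R} {E : Finset ι} {y : ι} {c m j : ℕ} {U V : Set (ℕ → ℕ)}

lemma profile_monotone (a : ι → ℕ) (E : Finset ι) : Monotone (profile a E) :=
  fun _ _ h => Finset.card_le_card
    (Finset.monotone_filter_right _ fun _ _ hi => le_trans hi h)

lemma profile_le_of_subset (a : ι → ℕ) {S E : Finset ι} (h : S ⊆ E) :
    profile a S ≤ profile a E :=
  fun _ => Finset.card_le_card (Finset.filter_subset_filter _ h)

lemma profile_empty (a : ι → ℕ) : profile a ∅ = 0 := by
  funext t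
  simp [profile]

lemma profile_congr {a a' : ι → ℕ} (h : ∀ i ∈ E, a i = a' i) : profile a E = profile a' E := by
  funext t
  unfold profile
  congr 1
  exact Finset.filter_congr fun i hi => by rw [h i hi]

lemma profile_insert [DecidableEq ι] (a : ι → ℕ) (hy : y ∉ E) :
    profile a (insert y E) = fun t => profile a E t + if a y ≤ t then 1 else 0 := by
  funext t
  unfold profile
  rw [Finset.filter_insert]
  split_ifs with h
  · rw [Finset.card_insert_of_notMem (by simp [hy])]
  · rfl

lemma profileIdeal_mono (h : ∀ a, profile a E ∈ U → profile a E ∈ V) :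
    profileIdeal F E U ≤ profileIdeal F E V :=
  Ideal.span_mono fun _ ⟨a, ha, hp⟩ => ⟨a, h a ha, hp⟩

lemma profileIdeal_union :
    profileIdeal F E (U ∪ V) = profileIdeal F E U ⊔ profileIdeal F E V := by
  refine le_antisymm (Ideal.span_le.2 ?_) (sup_le ?_ ?_)
  · rintro p ⟨a, ha | ha, hp⟩
    · exact Ideal.mem_sup_left (Ideal.subset_span ⟨a, ha, hp⟩)
    · exact Ideal.mem_sup_right (Ideal.subset_span ⟨a, ha, hp⟩)
  · exact profileIdeal_mono fun _ h => Or.inl h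
  · exact profileIdeal_mono fun _ h => Or.inr h

lemma profileIdeal_anti (hU : Admissible c m U) {S : Finset ι} (h : S ⊆ E) :
    profileIdeal F E U ≤ profileIdeal F S U := by
  classical
  refine Ideal.span_le.2 ?_
  rintro p ⟨a, ha, rfl⟩
  rw [← Finset.prod_sdiff h]
  exact Ideal.mul_mem_left _ _
    (Ideal.subset_span ⟨a, hU.of_le ha (profile_le_of_subset a h), rfl⟩)

lemma profileIdeal_empty_eq_top (h : (0 : ℕ → ℕ) ∈ U) :
    profileIdeal F (∅ : Finset ι) U = ⊤ := by
  rw [Ideal.eq_top_iff_one]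
  refine Ideal.subset_span ⟨0, ?_, by simp⟩
  rwa [profile_empty]

lemma profileIdeal_empty_eq_bot (h : (0 : ℕ → ℕ) ∉ U) :
    profileIdeal F (∅ : Finset ι) U = ⊥ := by
  rw [profileIdeal, Ideal.span_eq_bot]
  rintro p ⟨a, ha, -⟩
  exact absurd (profile_empty a ▸ ha) h

lemma profileIdeal_empty_le (hU : Admissible 0 m U) :
    profileIdeal F (∅ : Finset ι) U ≤ profileIdeal F E U := by
  by_cases h : (0 : ℕ → ℕ) ∈ U
  · refine le_of_le_of_eq le_top (Eq.symm ((Ideal.eq_top_iff_one _).2 ?_))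
    exact Ideal.subset_span ⟨0, hU _ h _ (by simp), by simp⟩
  · simp [profileIdeal_empty_eq_bot h]

lemma profileIdeal_slice_le_shiftIdeal :
    profileIdeal F E (slice U j) ≤ shiftIdeal F E y U j :=
  Ideal.span_mono fun _ ⟨a, ha, hp⟩ => ⟨0, a, by simpa using ha, by simpa using hp⟩

lemma mul_mem_shiftIdeal {f : R} (hf : f ∈ shiftIdeal F E y U (j + 1)) :
    F y * f ∈ shiftIdeal F E y U j := by
  induction hf using Submodule.span_induction with
  | mem p hp =>
    obtain ⟨b, a, ha, rfl⟩ := hp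
    refine Ideal.subset_span ⟨b + 1, a, ?_, by ring⟩
    rwa [show b + 1 + j = b + (j + 1) by ring]
  | zero => simp
  | add f g _ _ hf hg => rw [mul_add]; exact add_mem hf hg
  | smul r f _ hf =>
    rw [smul_eq_mul, mul_left_comm]
    exact Ideal.mul_mem_left _ _ hf

lemma exists_of_mem_shiftIdeal {f : R} (hf : f ∈ shiftIdeal F E y U j) :
    ∃ g ∈ profileIdeal F E (slice U j), ∃ h ∈ shiftIdeal F E y U (j + 1), f = g + F y * h := by
  induction hf using Submodule.span_induction with
  | mem p hp =>
    obtain ⟨b, a, ha, rfl⟩ := hp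
    cases b with
    | zero => exact ⟨_, Ideal.subset_span ⟨a, by simpa using ha, rfl⟩, 0, zero_mem _, by simp⟩
    | succ b =>
      refine ⟨0, zero_mem _, F y ^ b * ∏ i ∈ E, F i ^ a i, Ideal.subset_span ⟨b, a, ?_, rfl⟩,
        by ring⟩
      rwa [show b + (j + 1) = b + 1 + j by ring]
  | zero => exact ⟨0, zero_mem _, 0, zero_mem _, by simp⟩
  | add f g _ _ hf hg =>
    obtain ⟨u, hu, v, hv, rfl⟩ := hf
    obtain ⟨u', hu', v', hv', rfl⟩ := hg
    exact ⟨u + u', add_mem hu hu', v + v', add_mem hv hv', by ring⟩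
  | smul r f _ hf =>
    obtain ⟨u, hu, v, hv, rfl⟩ := hf
    exact ⟨r * u, Ideal.mul_mem_left _ _ hu, r * v, Ideal.mul_mem_left _ _ hv, by
      rw [smul_eq_mul]; ring⟩

lemma shiftIdeal_le (hU : Admissible c m U) : shiftIdeal F E y U j ≤ profileIdeal F E U := by
  refine Ideal.span_le.2 ?_
  rintro p ⟨b, a, ha, rfl⟩
  exact Ideal.mul_mem_left _ _ (Ideal.subset_span ⟨a, hU.slice_subset _ ha, rfl⟩)

lemma shiftIdeal_eq (hU : Admissible c m U) (h : m ≤ j) :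
    shiftIdeal F E y U j = profileIdeal F E U :=
  le_antisymm (shiftIdeal_le hU)
    ((profileIdeal_mono fun _ ha => hU.subset_slice h ha).trans profileIdeal_slice_le_shiftIdeal)

lemma profileIdeal_slice_le_shiftIdeal_succ (hU : Admissible c m U) :
    profileIdeal F E (slice U j) ≤ shiftIdeal F E y U (j + 1) :=
  (profileIdeal_mono fun _ ha => hU.slice_mono j.le_succ ha).trans
    profileIdeal_slice_le_shiftIdeal

lemma shiftIdeal_zero [DecidableEq ι] (hy : y ∉ E) :
    shiftIdeal F E y U 0 = profileIdeal F (insert y E) U := by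
  refine le_antisymm (Ideal.span_le.2 ?_) (Ideal.span_le.2 ?_)
  · rintro p ⟨b, a, ha, rfl⟩
    have hne : ∀ i ∈ E, Function.update a y b i = a i := fun i hi =>
      Function.update_of_ne (by rintro rfl; exact hy hi) _ _
    refine Ideal.subset_span ⟨Function.update a y b, ?_, ?_⟩
    · rw [profile_insert _ hy, profile_congr hne, Function.update_self]
      exact ha
    · rw [Finset.prod_insert hy, Function.update_self]
      exact congrArg _ (Finset.prod_congr rfl fun i hi => by rw [hne i hi])
  · rintro p ⟨a, ha, rfl⟩
    rw [profile_insert _ hy] at ha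
    exact Ideal.subset_span ⟨a y, a, ha, by rw [Finset.prod_insert hy]⟩

lemma mem_sup_span_insert [DecidableEq ι] {I : Ideal R} {Z : Finset ι} {f : R} :
    f ∈ I ⊔ Ideal.span (F '' (insert y Z : Finset ι)) ↔
      ∃ g ∈ I ⊔ Ideal.span (F '' (Z : Set ι)), ∃ h, f = g + F y * h := by
  have : I ⊔ Ideal.span (F '' (insert y Z : Finset ι)) =
      (I ⊔ Ideal.span (F '' (Z : Set ι))) ⊔ Ideal.span {F y} := by
    rw [Finset.coe_insert, Set.image_insert_eq, Ideal.span_insert, sup_assoc,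
      sup_comm (Ideal.span {F y})]
  rw [this, Submodule.mem_sup]
  constructor
  · rintro ⟨g, hg, z, hz, rfl⟩
    obtain ⟨h, rfl⟩ := Ideal.mem_span_singleton'.1 hz
    exact ⟨g, hg, h, by ring⟩
  · rintro ⟨g, hg, h, rfl⟩
    exact ⟨g, hg, F y * h, Ideal.mul_mem_right _ _ (Ideal.mem_span_singleton_self _), rfl⟩

lemma mul_mem_shiftIdeal_sup {K : Ideal R} {f : R} (hf : f ∈ shiftIdeal F E y U (j + 1) ⊔ K) :
    F y * f ∈ shiftIdeal F E y U j ⊔ K := by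
  obtain ⟨d, hd, k, hk, rfl⟩ := Submodule.mem_sup.1 hf
  rw [mul_add]
  exact add_mem (Ideal.mem_sup_left (mul_mem_shiftIdeal hd))
    (Ideal.mem_sup_right (Ideal.mul_mem_left _ _ hk))

lemma exists_of_mem_shiftIdeal_sup {K : Ideal R} {f : R} (hf : f ∈ shiftIdeal F E y U j ⊔ K) :
    ∃ g ∈ profileIdeal F E (slice U j) ⊔ K, ∃ h ∈ shiftIdeal F E y U (j + 1),
      f = g + F y * h := by
  obtain ⟨d, hd, k, hk, rfl⟩ := Submodule.mem_sup.1 hf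
  obtain ⟨g, hg, h, hh, rfl⟩ := exists_of_mem_shiftIdeal hd
  exact ⟨g + k, add_mem (Ideal.mem_sup_left hg) (Ideal.mem_sup_right hk), h, hh, by ring⟩

lemma mem_shiftIdeal_succ_sup (hU : Admissible c m U) {K : Ideal R} {f : R}
    (hy : ∀ f, F y * f ∈ profileIdeal F E (slice U j) ⊔ K →
      f ∈ profileIdeal F E (slice U j) ⊔ K)
    (hf : F y * f ∈ shiftIdeal F E y U j ⊔ K) : f ∈ shiftIdeal F E y U (j + 1) ⊔ K := by
  obtain ⟨g, hg, h, hh, e⟩ := exists_of_mem_shiftIdeal_sup hf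
  have h1 : f - h ∈ profileIdeal F E (slice U j) ⊔ K :=
    hy _ (by rwa [mul_sub, e, add_sub_cancel_right])
  have h2 := add_mem (sup_le_sup_right (profileIdeal_slice_le_shiftIdeal_succ hU) K h1)
    (Ideal.mem_sup_left hh)
  rwa [sub_add_cancel] at h2

end Ideals

section Regular

variable [DecidableEq ι] {F : ι → R} {C : ℕ}

/-- A further element of a regular sequence is a nonzerodivisor modulo a monomial ideal. -/
lemma RegularUpTo.mem_of_mul_mem (hF : RegularUpTo F C) {c m : ℕ} (S : Finset ι) :
    ∀ (Z : Finset ι) (x : ι) (U : Set (ℕ → ℕ)) (f : R), Admissible c m U → Disjoint S Z →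
      x ∉ S → x ∉ Z → S.card + Z.card ≤ C →
      F x * f ∈ profileIdeal F S U ⊔ Ideal.span (F '' (Z : Set ι)) →
      f ∈ profileIdeal F S U ⊔ Ideal.span (F '' (Z : Set ι)) := by
  induction S using Finset.induction_on with
  | empty =>
    intro Z x U f hU _ _ hxZ hC hf
    by_cases h0 : (0 : ℕ → ℕ) ∈ U
    · simp [profileIdeal_empty_eq_top h0]
    · rw [profileIdeal_empty_eq_bot h0, bot_sup_eq] at hf ⊢
      exact hF Z x hxZ (by simpa using hC) f hf
  | insert y S hyS ih =>
    intro Z x U f hU hSZ hxS hxZ hC hf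
    rw [Finset.disjoint_insert_left] at hSZ
    rw [Finset.mem_insert, not_or] at hxS
    rw [Finset.card_insert_of_notMem hyS] at hC
    have hcard : (insert y Z).card = Z.card + 1 := Finset.card_insert_of_notMem hSZ.1
    rw [← shiftIdeal_zero hyS] at hf ⊢
    suffices h : ∀ d j f, m ≤ j + d →
        F x * f ∈ shiftIdeal F S y U j ⊔ Ideal.span (F '' (Z : Set ι)) →
        f ∈ shiftIdeal F S y U j ⊔ Ideal.span (F '' (Z : Set ι)) from
      h m 0 f (by omega) hf
    intro d
    induction d with
    | zero =>
      intro j f hj hf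
      rw [shiftIdeal_eq hU (j := j) hj] at hf ⊢
      exact ih Z x U f hU hSZ.2 hxS.2 hxZ (by omega) hf
    | succ d ihd =>
      intro j f hj hf
      obtain ⟨g, hg, h, -, e⟩ := exists_of_mem_shiftIdeal_sup hf
      obtain ⟨g', hg', h', rfl⟩ := mem_sup_span_insert.1 <|
        ih (insert y Z) x _ f (hU.slice j) (Finset.disjoint_insert_right.2 ⟨hyS, hSZ.2⟩) hxS.2
          (by simp [hxS.1, hxZ]) (by omega) (mem_sup_span_insert.2 ⟨g, hg, h, e⟩)
      have hg'' := sup_le_sup_right (profileIdeal_slice_le_shiftIdeal (F := F) (y := y))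
        (Ideal.span (F '' (Z : Set ι))) hg'
      refine add_mem hg'' (mul_mem_shiftIdeal_sup (ihd _ _ (by omega) ?_))
      refine mem_shiftIdeal_succ_sup hU
        (fun f => ih Z y _ f (hU.slice j) hSZ.2 hyS hSZ.1 (by omega)) ?_
      have := sub_mem hf (Ideal.mul_mem_left _ (F x) hg'')
      rwa [mul_add, add_sub_cancel_left, mul_left_comm] at this

/-- Monomial ideals in a regular sequence intersect like monomial ideals. -/
lemma RegularUpTo.mem_inter (hF : RegularUpTo F C) {c m : ℕ} (S : Finset ι) :
    ∀ (Z : Finset ι) (U V : Set (ℕ → ℕ)) (f : R), Admissible c m U → Admissible c m V →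
      Disjoint S Z → S.card + Z.card ≤ C →
      f ∈ profileIdeal F S U ⊔ Ideal.span (F '' (Z : Set ι)) →
      f ∈ profileIdeal F S V ⊔ Ideal.span (F '' (Z : Set ι)) →
      f ∈ profileIdeal F S (U ∩ V) ⊔ Ideal.span (F '' (Z : Set ι)) := by
  induction S using Finset.induction_on with
  | empty =>
    intro Z U V f _ _ _ _ hfU hfV
    by_cases h0 : (0 : ℕ → ℕ) ∈ U
    · by_cases h1 : (0 : ℕ → ℕ) ∈ V
      · simp [profileIdeal_empty_eq_top (show (0 : ℕ → ℕ) ∈ U ∩ V from ⟨h0, h1⟩)]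
      · rw [profileIdeal_empty_eq_bot h1, bot_sup_eq] at hfV
        exact Ideal.mem_sup_right hfV
    · rw [profileIdeal_empty_eq_bot h0, bot_sup_eq] at hfU
      exact Ideal.mem_sup_right hfU
  | insert y S hyS ih =>
    intro Z U V f hU hV hSZ hC hfU hfV
    rw [Finset.disjoint_insert_left] at hSZ
    rw [Finset.card_insert_of_notMem hyS] at hC
    have hcard : (insert y Z).card = Z.card + 1 := Finset.card_insert_of_notMem hSZ.1
    rw [← shiftIdeal_zero hyS] at hfU hfV ⊢
    suffices h : ∀ d j f, m ≤ j + d →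
        f ∈ shiftIdeal F S y U j ⊔ Ideal.span (F '' (Z : Set ι)) →
        f ∈ shiftIdeal F S y V j ⊔ Ideal.span (F '' (Z : Set ι)) →
        f ∈ shiftIdeal F S y (U ∩ V) j ⊔ Ideal.span (F '' (Z : Set ι)) from
      h m 0 f (by omega) hfU hfV
    intro d
    induction d with
    | zero =>
      intro j f hj hfU hfV
      rw [shiftIdeal_eq hU (j := j) hj] at hfU
      rw [shiftIdeal_eq hV (j := j) hj] at hfV
      rw [shiftIdeal_eq (hU.inter hV) (j := j) hj]
      exact ih Z U V f hU hV hSZ.2 (by omega) hfU hfV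
    | succ d ihd =>
      intro j f hj hfU hfV
      obtain ⟨g, hg, h, -, e⟩ := exists_of_mem_shiftIdeal_sup hfU
      obtain ⟨g₂, hg₂, h₂, -, e₂⟩ := exists_of_mem_shiftIdeal_sup hfV
      obtain ⟨g', hg', h', rfl⟩ := mem_sup_span_insert.1 <|
        ih (insert y Z) _ _ f (hU.slice j) (hV.slice j)
          (Finset.disjoint_insert_right.2 ⟨hyS, hSZ.2⟩) (by omega)
          (mem_sup_span_insert.2 ⟨g, hg, h, e⟩) (mem_sup_span_insert.2 ⟨g₂, hg₂, h₂, e₂⟩)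
      have hle : ∀ W, slice U j ∩ slice V j ⊆ slice W j →
          g' ∈ shiftIdeal F S y W j ⊔ Ideal.span (F '' (Z : Set ι)) := fun W hW =>
        sup_le_sup_right ((profileIdeal_mono fun _ ha => hW ha).trans
          profileIdeal_slice_le_shiftIdeal) (Ideal.span (F '' (Z : Set ι))) hg'
      have hcolon : ∀ W, Admissible c m W → slice U j ∩ slice V j ⊆ slice W j →
          g' + F y * h' ∈ shiftIdeal F S y W j ⊔ Ideal.span (F '' (Z : Set ι)) →
          h' ∈ shiftIdeal F S y W (j + 1) ⊔ Ideal.span (F '' (Z : Set ι)) := by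
        intro W hW hsub hf
        refine mem_shiftIdeal_succ_sup hW
          (fun f => hF.mem_of_mul_mem S Z y _ f (hW.slice j) hSZ.2 hyS hSZ.1 (by omega)) ?_
        have := sub_mem hf (hle W hsub)
        rwa [add_sub_cancel_left] at this
      exact add_mem (hle _ fun _ h => h) (mul_mem_shiftIdeal_sup (ihd _ _ (by omega)
        (hcolon U hU Set.inter_subset_left hfU) (hcolon V hV Set.inter_subset_right hfV)))

/-- The ideal of an admissible set of profiles is the intersection of the corresponding ideals for
the subfamilies of cardinality `c`. -/
theorem RegularUpTo.mem_profileIdeal (hF : RegularUpTo F C) {m : ℕ} (E : Finset ι) :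
    ∀ (c : ℕ) (Z : Finset ι) (U : Set (ℕ → ℕ)) (f : R), Admissible c m U → Disjoint E Z →
      c ≤ E.card → c + Z.card ≤ C →
      (∀ S ⊆ E, S.card = c → f ∈ profileIdeal F S U ⊔ Ideal.span (F '' (Z : Set ι))) →
      f ∈ profileIdeal F E U ⊔ Ideal.span (F '' (Z : Set ι)) := by
  induction E using Finset.induction_on with
  | empty =>
    intro c Z U f _ _ hc _ hf
    exact hf ∅ le_rfl (by simpa using hc.antisymm')
  | insert y E hyE ih =>
    intro c Z U f hU hEZ hcE hC hf
    obtain hcE | hcE := hcE.eq_or_lt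
    · exact hf _ le_rfl hcE.symm
    cases c with
    | zero =>
      exact sup_le_sup_right (profileIdeal_empty_le hU) (Ideal.span (F '' (Z : Set ι)))
        (hf ∅ (by simp) rfl)
    | succ c =>
    rw [Finset.disjoint_insert_left] at hEZ
    rw [Finset.card_insert_of_notMem hyE] at hcE
    have hcard : (insert y Z).card = Z.card + 1 := Finset.card_insert_of_notMem hEZ.1
    rw [← shiftIdeal_zero hyE]
    set K := Ideal.span (F '' (Z : Set ι))
    suffices h : ∀ d j f, m ≤ j + d →
        f ∈ profileIdeal F E U ⊔ K →
        (∀ T ⊆ E, T.card = c → f ∈ shiftIdeal F T y U j ⊔ K) →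
        f ∈ shiftIdeal F E y U j ⊔ K by
      refine h m 0 f (by omega) (ih _ Z U f hU hEZ.2 (by omega) hC fun S hS hSc =>
        hf S (hS.trans (Finset.subset_insert _ _)) hSc) fun T hT hTc => ?_
      rw [shiftIdeal_zero fun h => hyE (hT h)]
      exact hf _ (Finset.insert_subset_insert _ hT)
        (by rw [Finset.card_insert_of_notMem fun h => hyE (hT h), hTc])
    intro d
    induction d with
    | zero =>
      intro j f hj hfE _
      rwa [shiftIdeal_eq hU (j := j) hj]
    | succ d ihd =>
      intro j f hj hfE hfT
      let V : Set (ℕ → ℕ) := {N | (fun t => min c (N t)) ∈ slice U j}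
      have hV : Admissible c m V := (hU.slice j).truncate c
      have hV' : Admissible (c + 1) m V := hV.mono c.le_succ
      have hmod : f ∈ profileIdeal F E V ⊔ Ideal.span (F '' (insert y Z : Finset ι)) := by
        refine ih c (insert y Z) V f hV (Finset.disjoint_insert_right.2 ⟨hyE, hEZ.2⟩) (by omega)
          (by omega) fun T hT hTc => ?_
        obtain ⟨g, hg, h, -, e⟩ := exists_of_mem_shiftIdeal_sup (hfT T hT hTc)
        refine mem_sup_span_insert.2 ⟨g, sup_le_sup_right (profileIdeal_mono fun a ha => ?_) K hg,
          h, e⟩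
        exact (hU.slice j).of_le ha fun t => min_le_right _ _
      obtain ⟨g, hg, h, e⟩ := mem_sup_span_insert.1 hmod
      have hh : h ∈ profileIdeal F E (U ∪ V) ⊔ K := by
        have hyh : F y * h ∈ profileIdeal F E (U ∪ V) ⊔ K := by
          rw [← add_sub_cancel_left g (F y * h), ← e]
          exact sub_mem (sup_le_sup_right (profileIdeal_mono fun _ ha => Or.inl ha) K hfE)
            (sup_le_sup_right (profileIdeal_mono fun _ ha => Or.inr ha) K hg)
        refine ih _ Z _ h (hU.union hV') hEZ.2 (by omega) hC fun S hS hSc => ?_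
        exact hF.mem_of_mul_mem S Z y _ h (hU.union hV')
          (Finset.disjoint_of_subset_left hS hEZ.2) (fun hy => hyE (hS hy)) hEZ.1 (by omega)
          (sup_le_sup_right (profileIdeal_anti (hU.union hV') hS) K hyh)
      rw [profileIdeal_union, sup_assoc] at hh
      obtain ⟨h₁, hh₁, h₂, hh₂, rfl⟩ := Submodule.mem_sup.1 hh
      have hpU : f - F y * h₁ ∈ profileIdeal F E U ⊔ K :=
        sub_mem hfE (Ideal.mul_mem_left _ _ (Ideal.mem_sup_left hh₁))
      have hpV : f - F y * h₁ ∈ profileIdeal F E V ⊔ K := by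
        have := add_mem hg (Ideal.mul_mem_left _ (F y) hh₂)
        rwa [show g + F y * h₂ = f - F y * h₁ by rw [e]; ring] at this
      have hp : f - F y * h₁ ∈ profileIdeal F E (slice U j) ⊔ K := by
        refine sup_le_sup_right (profileIdeal_mono fun a ha =>
          hU.mem_slice (profile_monotone a E) ha.1 ha.2) K
          (ih _ Z _ _ (hU.inter hV') hEZ.2 (by omega) hC fun S hS hSc => ?_)
        exact hF.mem_inter S Z U V _ hU hV' (Finset.disjoint_of_subset_left hS hEZ.2) (by omega)
          (sup_le_sup_right (profileIdeal_anti hU hS) K hpU)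
          (sup_le_sup_right (profileIdeal_anti hV hS) K hpV)
      rw [← sub_add_cancel f (F y * h₁)]
      refine add_mem (sup_le_sup_right profileIdeal_slice_le_shiftIdeal K hp)
        (mul_mem_shiftIdeal_sup (ihd _ _ (by omega) (Ideal.mem_sup_left hh₁) fun T hT hTc => ?_))
      refine mem_shiftIdeal_succ_sup hU (fun f => hF.mem_of_mul_mem T Z y _ f (hU.slice j)
        (Finset.disjoint_of_subset_left hT hEZ.2) (fun hy => hyE (hT hy)) hEZ.1 (by omega)) ?_
      have := sub_mem (hfT T hT hTc) (sup_le_sup_right ((profileIdeal_anti (hU.slice j) hT).trans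
        profileIdeal_slice_le_shiftIdeal) K hp)
      rwa [sub_sub_cancel] at this

end Regular

section Symbolic

/-- The profiles whose `c` smallest exponents have sum at least `m`. -/
def symbolicProfiles (c m : ℕ) : Set (ℕ → ℕ) := {N | m ≤ ∑ t ∈ Finset.range m, (c - N t)}

lemma mem_symbolicProfiles {c m : ℕ} {N : ℕ → ℕ} :
    N ∈ symbolicProfiles c m ↔ m ≤ ∑ t ∈ Finset.range m, (c - N t) :=
  Iff.rfl

lemma admissible_symbolicProfiles (c m : ℕ) : Admissible c m (symbolicProfiles c m) := by
  intro N hN N' h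
  refine (mem_symbolicProfiles.1 hN).trans (Finset.sum_le_sum fun t ht => ?_)
  have := h t (Finset.mem_range.1 ht)
  omega

lemma sum_card_sub_profile (a : ι → ℕ) (S : Finset ι) (m : ℕ) :
    ∑ t ∈ Finset.range m, (S.card - profile a S t) = ∑ i ∈ S, min (a i) m := by
  have h1 : ∀ t, S.card - profile a S t = ∑ i ∈ S, if t < a i then 1 else 0 := by
    intro t
    rw [← Finset.card_filter, profile]
    have := Finset.card_filter_add_card_filter_not (s := S) (fun i => a i ≤ t)
    simp only [not_le] at this
    omega
  simp_rw [h1]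
  rw [Finset.sum_comm]
  refine Finset.sum_congr rfl fun i _ => ?_
  rw [← Finset.card_filter, ← Finset.card_range (min (a i) m)]
  congr 1
  ext t
  simp [and_comm]

lemma le_sum_of_profile_mem {c m : ℕ} {a : ι → ℕ} {E S : Finset ι}
    (ha : profile a E ∈ symbolicProfiles c m) (hS : S ⊆ E) (hc : S.card = c) :
    m ≤ ∑ i ∈ S, a i := by
  have h := (admissible_symbolicProfiles c m).of_le ha (profile_le_of_subset a hS)
  rw [mem_symbolicProfiles, ← hc, sum_card_sub_profile] at h
  exact h.trans (Finset.sum_le_sum fun i _ => min_le_left _ _)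

lemma span_image_pow_le (F : ι → R) (S : Finset ι) (m : ℕ) :
    Ideal.span (F '' (S : Set ι)) ^ m ≤
      Ideal.span {p | ∃ a : ι → ℕ, ∑ i ∈ S, a i = m ∧ p = ∏ i ∈ S, F i ^ a i} := by
  classical
  induction m with
  | zero =>
    refine le_of_le_of_eq le_top (Eq.symm ((Ideal.eq_top_iff_one _).2 ?_))
    exact Ideal.subset_span ⟨0, by simp, by simp⟩
  | succ m ih =>
    rw [pow_succ]
    refine (Ideal.mul_mono_left ih).trans ?_
    rw [Ideal.span_mul_span', Ideal.span_le]
    rintro _ ⟨_, ⟨a, ha, rfl⟩, _, ⟨y, hy, rfl⟩, rfl⟩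
    refine Ideal.subset_span ⟨a + Pi.single y 1, ?_, ?_⟩
    · simp [Finset.sum_add_distrib, ha, Finset.mem_coe.1 hy]
    · have : ∏ i ∈ S, F i ^ (Pi.single y 1 : ι → ℕ) i = F y := by
        rw [Finset.prod_eq_single_of_mem y hy fun i _ hi => by simp [hi]]
        simp
      simp only [Pi.add_apply, pow_add, Finset.prod_mul_distrib, this]

lemma span_image_pow_le_profileIdeal (F : ι → R) (S : Finset ι) (m : ℕ) :
    Ideal.span (F '' (S : Set ι)) ^ m ≤ profileIdeal F S (symbolicProfiles S.card m) := by
  refine (span_image_pow_le F S m).trans (Ideal.span_mono ?_)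
  rintro p ⟨a, ha, rfl⟩
  refine ⟨a, ?_, rfl⟩
  rw [mem_symbolicProfiles, sum_card_sub_profile]
  refine le_of_eq (ha.symm.trans (Finset.sum_congr rfl fun i hi => (min_eq_left ?_).symm))
  exact (Finset.single_le_sum (fun _ _ => Nat.zero_le _) hi).trans ha.le

lemma prod_pow_mem_span_pow (F : ι → R) {m : ℕ} {a : ι → ℕ} {S E : Finset ι} (hSE : S ⊆ E)
    (h : m ≤ ∑ i ∈ S, a i) : ∏ i ∈ E, F i ^ a i ∈ Ideal.span (F '' (S : Set ι)) ^ m := by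
  classical
  rw [← Finset.prod_sdiff hSE]
  refine Ideal.mul_mem_left _ _ (Ideal.pow_le_pow_right h ?_)
  rw [← Finset.prod_pow_eq_pow_sum]
  exact Ideal.prod_mem_prod fun i hi =>
    Ideal.pow_mem_pow (Ideal.subset_span (Set.mem_image_of_mem F hi)) _

lemma regularUpTo_of_isRegular (F : ι → R) (C : ℕ)
    (h : ∀ L : List ι, L.Nodup → L.length ≤ C + 1 →
      RingTheory.Sequence.IsRegular R (L.map F)) : RegularUpTo F C := by
  intro Z x hx hZ f hf
  have h1 := (h (Z.toList ++ [x]) (by simp [List.nodup_append, Z.nodup_toList]; grind)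
    (by simpa using hZ)).toIsWeaklyRegular
  rw [List.map_append, RingTheory.Sequence.isWeaklyRegular_append_iff, List.map_singleton,
    RingTheory.Sequence.isWeaklyRegular_singleton_iff] at h1
  have h2 := h1.2
  have hI : Ideal.ofList (Z.toList.map F) = Ideal.span (F '' (Z : Set ι)) := by
    rw [Ideal.ofList]
    congr 1
    ext p
    simp
  rw [hI, isSMulRegular_quotient_iff_mem_of_smul_mem] at h2
  simpa using h2 f (by simpa using hf)

end Symbolic

end StarConfiguration

open StarConfiguration in
/-- A monomial in the `F i` of small support which lies in the symbolic power lies in the ordinary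
power of the star configuration ideal. -/
lemma prod_pow_mem_starIdeal_pow {k : Type*} [Field k] {n s c m : ℕ} (hc : 1 ≤ c) (hcs : c ≤ s)
    (hm : 1 ≤ m) (F : Fin s → MvPolynomial (Fin (n + 1)) k) (a : Fin s → ℕ)
    (hcard : (Finset.univ.filter fun i => 0 < a i).card < s - c + 2)
    (ha : ∀ S : Finset (Fin s), S.card = c → m ≤ ∑ i ∈ S, a i) :
    ∏ i, F i ^ a i ∈ starIdeal F c ^ m := by
  set T := Finset.univ.filter fun i => 0 < a i with hT
  have hzero : c - 1 ≤ (Finset.univ.filter fun i => ¬ 0 < a i).card := by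
    have := Finset.card_filter_add_card_filter_not (s := Finset.univ) (fun i => 0 < a i)
    rw [Finset.card_univ, Fintype.card_fin, ← hT] at this
    omega
  obtain ⟨Z, hZ, hZc⟩ := Finset.exists_subset_card_eq hzero
  have hZ0 : ∀ i ∈ Z, a i = 0 := fun i hi => by simpa using hZ hi
  have hle : ∀ i ∈ T, m ≤ a i := by
    intro i hi
    have hiZ : i ∉ Z := fun h => by simp [hT, hZ0 i h] at hi
    have := ha (insert i Z) (by rw [Finset.card_insert_of_notMem hiZ]; omega)
    rwa [Finset.sum_insert hiZ, Finset.sum_eq_zero hZ0, add_zero] at this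
  have hprod : ∏ i ∈ T, F i ∈ starIdeal F c := by
    simp only [starIdeal, Ideal.mem_iInf]
    intro S hS
    obtain ⟨i, hiS, hi⟩ : ∃ i ∈ S, a i ≠ 0 := by
      by_contra! h
      have := ha S hS
      rw [Finset.sum_eq_zero h] at this
      omega
    exact Ideal.mem_of_dvd _ (Finset.dvd_prod_of_mem F (by simp [hT]; omega))
      (Ideal.subset_span ⟨i, hiS, rfl⟩)
  have hdvd : (∏ i ∈ T, F i) ^ m ∣ ∏ i, F i ^ a i := by
    rw [← Finset.prod_pow]
    exact (Finset.prod_dvd_prod_of_dvd _ _ fun i hi => pow_dvd_pow _ (hle i hi)).trans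
      (Finset.prod_dvd_prod_of_subset _ _ _ (Finset.subset_univ _))
  exact Ideal.mem_of_dvd _ hdvd (Ideal.pow_mem_pow hprod m)

open StarConfiguration in
theorem star_symbolic_power_decomposition (k : Type*) [Field k] (n s c m : ℕ)
    (hc : 1 ≤ c) (hcn : c ≤ n) (hcs : c ≤ s) (hm : 1 ≤ m)
    (F : Fin s → MvPolynomial (Fin (n + 1)) k)
    (hF : ∀ i, ∃ d, 0 < d ∧ (F i).IsHomogeneous d)
    (hreg : ∀ L : List (Fin s), L.Nodup → L.length ≤ c + 1 →
      RingTheory.Sequence.IsRegular (MvPolynomial (Fin (n + 1)) k) (L.map F)) :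
    starSymb F c m =
      starIdeal F c ^ m +
        Ideal.span {p : MvPolynomial (Fin (n + 1)) k |
          ∃ a : Fin s → ℕ, p = ∏ i, F i ^ a i ∧
            s - c + 2 ≤ (Finset.univ.filter fun i => 0 < a i).card ∧
            ∀ S : Finset (Fin s), S.card = c → m ≤ ∑ i ∈ S, a i} := by
  rw [Submodule.add_eq_sup]
  refine le_antisymm (fun f hf => ?_) (sup_le ?_ (Ideal.span_le.2 ?_))
  · have hmem : f ∈ profileIdeal F Finset.univ (symbolicProfiles c m) := by
      have := (regularUpTo_of_isRegular F c hreg).mem_profileIdeal Finset.univ c ∅ _ f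
        (admissible_symbolicProfiles c m) (by simp) (by simpa using hcs) (by simp) ?_
      · simpa using this
      · intro S _ hS
        simp only [starSymb, Ideal.mem_iInf] at hf
        refine Ideal.mem_sup_left ?_
        rw [← hS]
        exact span_image_pow_le_profileIdeal F S m (hf S hS)
    refine (Ideal.span_le.2 ?_ : profileIdeal F Finset.univ _ ≤ _) hmem
    rintro p ⟨a, ha, rfl⟩
    have hS : ∀ S : Finset (Fin s), S.card = c → m ≤ ∑ i ∈ S, a i := fun S hS =>
      le_sum_of_profile_mem ha (Finset.subset_univ S) hS
    by_cases hcard : s - c + 2 ≤ (Finset.univ.filter fun i => 0 < a i).card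
    · exact Ideal.mem_sup_right (Ideal.subset_span ⟨a, rfl, hcard, hS⟩)
    · exact Ideal.mem_sup_left
        (prod_pow_mem_starIdeal_pow hc hcs hm F a (not_le.1 hcard) hS)
  · exact le_iInf₂ fun S hS => Ideal.pow_right_mono (iInf₂_le S hS) m
  · rintro p ⟨a, rfl, -, ha⟩
    simp only [starSymb, SetLike.mem_coe, Ideal.mem_iInf]
    exact fun S hS => prod_pow_mem_span_pow F (Finset.subset_univ S) (ha S hS)
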